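/- Let Z and V be real Banach spaces with a continuous dense embedding j : Z → V, where V is reflexive, and let R : Z → [0,∞] be a proper, positively 1-homogeneous, convex and continuous function. Let (ξ_n)_{n∈ℕ} ⊆ Z* and ξ ∈ Z* be such that liminf_{n→∞} ⟨ξ_n, −v⟩ ≥ ⟨ξ, −v⟩ for every v ∈ Z with R(v) < ∞, and suppose there exists C > 0 with dist_{V*}(−ξ_n, ∂R(0)) ≤ C for all n ∈ ℕ. Then liminf_{n→∞} dist_{V*}(−ξ_n, ∂R(0)) ≥ dist_{V*}(−ξ, ∂R(0)). -/

import Mathlib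

open Filter
open scoped ENNReal

noncomputable section

/-- The subdifferential of an `[0,∞]`-valued convex function at a point. -/
def Subdiff {Z : Type*} [NormedAddCommGroup Z] [NormedSpace ℝ Z]
    (f : Z → ℝ≥0∞) (v : Z) : Set (Z →L[ℝ] ℝ) :=
  {ξ | ∀ w : Z, (f v : EReal) + ((ξ (w - v) : ℝ) : EReal) ≤ (f w : EReal)}

/-- `dist_{V*}(ζ, A) = inf { ‖η‖_{V*} : η ∈ V*, ζ - j*η ∈ A }`, with `inf ∅ = ∞`. -/
def DistVStar {Z V : Type*} [NormedAddCommGroup Z] [NormedSpace ℝ Z]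
    [NormedAddCommGroup V] [NormedSpace ℝ V] (j : Z →L[ℝ] V)
    (ζ : Z →L[ℝ] ℝ) (A : Set (Z →L[ℝ] ℝ)) : ℝ≥0∞ :=
  ⨅ η ∈ {η : V →L[ℝ] ℝ | ζ - η.comp j ∈ A}, (‖η‖₊ : ℝ≥0∞)

/-- Convexity of an `[0,∞]`-valued function. -/
def ConvexOnENN {Z : Type*} [NormedAddCommGroup Z] [NormedSpace ℝ Z]
    (f : Z → ℝ≥0∞) : Prop :=
  ∀ x y : Z, ∀ a b : ℝ, 0 ≤ a → 0 ≤ b → a + b = 1 →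
    f (a • x + b • y) ≤ ENNReal.ofReal a * f x + ENNReal.ofReal b * f y

/-- Positive 1-homogeneity of an `[0,∞]`-valued function. -/
def PosOneHom {Z : Type*} [NormedAddCommGroup Z] [NormedSpace ℝ Z]
    (f : Z → ℝ≥0∞) : Prop :=
  f 0 = 0 ∧ ∀ c : ℝ, 0 < c → ∀ u : Z, f (c • u) = ENNReal.ofReal c * f u

theorem mem_subdiff_zero_iff {Z : Type*} [NormedAddCommGroup Z] [NormedSpace ℝ Z]
    {f : Z → ℝ≥0∞} (hf : f 0 = 0) {ζ : Z →L[ℝ] ℝ} :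
    ζ ∈ Subdiff f 0 ↔ ∀ w, f w ≠ ⊤ → ζ w ≤ (f w).toReal := by
  have key : ∀ w, ((f 0 : EReal) + ((ζ (w - 0) : ℝ) : EReal) ≤ (f w : EReal)) ↔
      (f w ≠ ⊤ → ζ w ≤ (f w).toReal) := by
    intro w
    rw [hf, sub_zero, EReal.coe_ennreal_zero, zero_add]
    by_cases hw : f w = ⊤
    · simp [hw]
    · rw [← EReal.coe_ennreal_toReal hw, EReal.coe_le_coe_iff]
      simp [hw]
  exact forall_congr' key

/-- Given bounded functionals along an ultrafilter, their weak-* limit (Banach–Alaoglu). -/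
theorem exists_tendsto_apply_of_eventually_norm_le {ι V : Type*} [NormedAddCommGroup V]
    [NormedSpace ℝ V] (U : Ultrafilter ι) (η : ι → V →L[ℝ] ℝ) {c : ℝ}
    (h : ∀ᶠ n in (U : Filter ι), ‖η n‖ ≤ c) :
    ∃ η' : V →L[ℝ] ℝ, ‖η'‖ ≤ c ∧ ∀ v, Tendsto (fun n => η n v) U (nhds (η' v)) := by
  have hK := WeakDual.isCompact_closedBall (𝕜 := ℝ) (E := V) (0 : StrongDual ℝ V) c
  obtain ⟨y, hy, hlim⟩ := isCompact_iff_ultrafilter_le_nhds.1 hK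
    (U.map fun n => StrongDual.toWeakDual (η n)) (by
      rw [le_principal_iff]
      refine mem_map.2 (h.mono fun n hn => ?_)
      simpa using hn)
  refine ⟨WeakDual.toStrongDual y, by simpa using hy, fun v => ?_⟩
  exact ((WeakDual.eval_continuous v).tendsto y).comp hlim

/-- **Lower semicontinuity of the `V*`-distance term.**
Let `Z`, `V` be real Banach spaces with a continuous dense embedding `j : Z → V`, where
`V` is reflexive, and `R : Z → [0,∞]` proper, positively 1-homogeneous, convex and
continuous. Let `(ξ_n) ⊆ Z*` and `ξ ∈ Z*` with `liminf_n ⟨ξ_n, -v⟩ ≥ ⟨ξ, -v⟩` for every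
`v ∈ Z` with `R v < ∞`, and `dist_{V*}(-ξ_n, ∂R(0)) ≤ C` uniformly in `n` for some
`C > 0`. Then `liminf_n dist_{V*}(-ξ_n, ∂R(0)) ≥ dist_{V*}(-ξ, ∂R(0))`. -/
theorem statement8
    {Z V : Type*} [NormedAddCommGroup Z] [NormedSpace ℝ Z] [CompleteSpace Z]
    [NormedAddCommGroup V] [NormedSpace ℝ V] [CompleteSpace V]
    (j : Z →L[ℝ] V) (hjinj : Function.Injective j) (hjdense : DenseRange j)
    (hVrefl : Function.Surjective (NormedSpace.inclusionInDoubleDual ℝ V))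
    (R : Z → ℝ≥0∞) (hRproper : ∃ z, R z ≠ ⊤) (hRhom : PosOneHom R)
    (hRconv : ConvexOnENN R) (hRcont : Continuous R)
    (ξ : ℕ → (Z →L[ℝ] ℝ)) (ξ' : Z →L[ℝ] ℝ)
    (hliminf : ∀ v : Z, R v ≠ ⊤ →
      ((ξ' (-v) : ℝ) : EReal) ≤ Filter.liminf (fun n => ((ξ n (-v) : ℝ) : EReal)) Filter.atTop)
    (C : ℝ) (hC : 0 < C)
    (hbound : ∀ n : ℕ, DistVStar j (-(ξ n)) (Subdiff R 0) ≤ ENNReal.ofReal C) :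
    DistVStar j (-ξ') (Subdiff R 0)
      ≤ Filter.liminf (fun n => DistVStar j (-(ξ n)) (Subdiff R 0)) Filter.atTop := by
  have hR0 : R 0 = 0 := hRhom.1
  refine le_of_forall_gt_imp_ge_of_dense fun c hc => ?_
  rcases eq_or_ne c ⊤ with rfl | hctop
  · exact le_top
  have hfreq : ∃ᶠ n in atTop, DistVStar j (-(ξ n)) (Subdiff R 0) < c :=
    frequently_lt_of_liminf_lt (by isBoundedDefault) hc
  have hex : ∃ᶠ n in atTop, ∃ η : V →L[ℝ] ℝ,
      -(ξ n) - η.comp j ∈ Subdiff R 0 ∧ ‖η‖ ≤ c.toReal := by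
    refine hfreq.mono fun n hn => ?_
    simp only [DistVStar, iInf_lt_iff] at hn
    obtain ⟨η, hη, hlt⟩ := hn
    exact ⟨η, hη, by simpa using ENNReal.toReal_mono hctop hlt.le⟩
  have hne : (atTop ⊓ principal {n | ∃ η : V →L[ℝ] ℝ,
      -(ξ n) - η.comp j ∈ Subdiff R 0 ∧ ‖η‖ ≤ c.toReal}).NeBot :=
    frequently_mem_iff_neBot.1 hex
  obtain ⟨U, hUle⟩ := exists_ultrafilter_iff.2 hne
  have hU : (U : Filter ℕ) ≤ atTop := hUle.trans inf_le_left
  have hUex : ∀ᶠ n in (U : Filter ℕ), ∃ η : V →L[ℝ] ℝ,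
      -(ξ n) - η.comp j ∈ Subdiff R 0 ∧ ‖η‖ ≤ c.toReal := le_principal_iff.1 (hUle.trans inf_le_right)
  obtain ⟨η, hη⟩ := hUex.choice
  obtain ⟨η', hη'c, hlim⟩ :=
    exists_tendsto_apply_of_eventually_norm_le U η (hη.mono fun n hn => hn.2)
  have hmem : -ξ' - η'.comp j ∈ Subdiff R 0 := by
    rw [mem_subdiff_zero_iff hR0]
    intro w hw
    have hle : ((ξ' (-w) : ℝ) : EReal) ≤ (((R w).toReal + η' (j w) : ℝ) : EReal) := by
      have hT : Tendsto (fun n => (((R w).toReal + η n (j w) : ℝ) : EReal)) U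
          (nhds (((R w).toReal + η' (j w) : ℝ) : EReal)) :=
        (continuous_coe_real_ereal.tendsto _).comp ((hlim (j w)).const_add _)
      rw [← hT.liminf_eq]
      refine (hliminf w hw).trans ((liminf_le_liminf_of_le hU).trans (liminf_le_liminf ?_))
      filter_upwards [hη] with n hn
      have := (mem_subdiff_zero_iff hR0).1 hn.1 w hw
      rw [EReal.coe_le_coe_iff, map_neg]
      simp at this
      linarith
    rw [EReal.coe_le_coe_iff, map_neg] at hle
    simp
    linarith
  calc DistVStar j (-ξ') (Subdiff R 0) ≤ (‖η'‖₊ : ℝ≥0∞) := iInf₂_le η' hmem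
    _ ≤ c := by
      rw [← ENNReal.toReal_le_toReal ENNReal.coe_ne_top hctop]
      simpa using hη'c
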